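/- Let f : ℝ^d → ℝ be twice continuously differentiable, bounded below, and satisfy the local PL condition at a local minimizer x*. Assume there exist constants 0 < μ ≤ L such that in some neighborhood of x*, every nonzero eigenvalue of the Hessian ∇²f(x') lies in [μ, L] for every x' ∈ 𝒮 in that neighborhood. Then for every sufficiently small ε > 0 there exist an open neighborhood 𝒰 ⊂ ℝ^d × ℝ^d of (x*, 0) and a constant C_ε > 0 such that, with the optimal damping parameter γ = 2√μ, every twice differentiable trajectory x : [0,∞) → ℝ^d solving ẍ(t) + γ ẋ(t) + ∇f(x(t)) = 0 with (x(0), ẋ(0)) ∈ 𝒰 converges to some local minimizer x' ∈ 𝒮 with the optimal exponential rate ‖x(t) − x'‖ ≤ C_ε (‖x(0) − x'‖ + ‖ẋ(0)‖) e^{−(√μ − ε) t} for all t ≥ 0. -/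

import Mathlib

/-- `f` satisfies the local Polyak–Łojasiewicz condition at the local minimizer `xs`. -/
def LocalPL {d : ℕ} (f : EuclideanSpace ℝ (Fin d) → ℝ) (xs : EuclideanSpace ℝ (Fin d)) : Prop :=
  ∃ U : Set (EuclideanSpace ℝ (Fin d)), IsOpen U ∧ xs ∈ U ∧
    ∃ ν : ℝ, 0 < ν ∧ ∀ x ∈ U, 2 * ν * (f x - f xs) ≤ ‖gradient f x‖ ^ 2

/-- `𝒮`: the set of local minimizers of `f` at the same level as `xs`. -/
def minSet {d : ℕ} (f : EuclideanSpace ℝ (Fin d) → ℝ) (xs : EuclideanSpace ℝ (Fin d)) :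
    Set (EuclideanSpace ℝ (Fin d)) :=
  {p | IsLocalMin f p ∧ f p = f xs}

/-- `(x, v)` is a twice differentiable trajectory of the Heavy Ball flow
`ẍ + γ ẋ + ∇f(x) = 0` on `[0, ∞)`, with `v = ẋ`. -/
def IsHeavyBall {d : ℕ} (f : EuclideanSpace ℝ (Fin d) → ℝ) (γ : ℝ)
    (x v : ℝ → EuclideanSpace ℝ (Fin d)) : Prop :=
  (∀ t ∈ Set.Ici (0 : ℝ), HasDerivWithinAt x (v t) (Set.Ici (0 : ℝ)) t) ∧
  (∀ t ∈ Set.Ici (0 : ℝ),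
    HasDerivWithinAt v (-(γ • v t) - gradient f (x t)) (Set.Ici (0 : ℝ)) t)

open Set Filter Topology
open scoped RealInnerProductSpace

/-- A Grönwall inequality for `g' ≤ -a g` on a compact interval. -/
theorem le_mul_exp_of_deriv_le {g g' : ℝ → ℝ} {a T : ℝ} (hT : 0 ≤ T)
    (hg : ∀ t ∈ Icc 0 T, HasDerivWithinAt g (g' t) (Ici 0) t)
    (hle : ∀ t ∈ Ico 0 T, g' t ≤ -a * g t) : g T ≤ g 0 * Real.exp (-a * T) := by
  have hexp : ∀ t : ℝ, HasDerivAt (fun t => Real.exp (a * t)) (Real.exp (a * t) * a) t := fun t => by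
    simpa using ((hasDerivAt_id t).const_mul a).exp
  have hder : ∀ t ∈ Icc 0 T, HasDerivWithinAt (fun t => g t * Real.exp (a * t))
      (g' t * Real.exp (a * t) + g t * (Real.exp (a * t) * a)) (Ici 0) t := fun t ht =>
    (hg t ht).mul (hexp t).hasDerivWithinAt
  have key := image_le_of_deriv_right_le_deriv_boundary (B := fun _ => g 0) (B' := fun _ => 0)
    (fun t ht => (hder t ht).continuousWithinAt.mono Icc_subset_Ici_self)
    (fun t ht => (hder t (Ico_subset_Icc_self ht)).mono (Ici_subset_Ici.2 ht.1))
    (by simp) continuousOn_const (fun t _ => hasDerivWithinAt_const _ _ _)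
    (fun t ht => by nlinarith [hle t ht, Real.exp_pos (a * t)]) (right_mem_Icc.2 hT)
  have h1 : Real.exp (a * T) * Real.exp (-a * T) = 1 := by
    rw [← Real.exp_add]; simp
  calc g T = g T * Real.exp (a * T) * Real.exp (-a * T) := by rw [mul_assoc, h1, mul_one]
    _ ≤ g 0 * Real.exp (-a * T) := by gcongr

/-- Cone argument: if the slow component `Z` decays fast, it is dominated by the
fast component `W`, which then decays at nearly its own rate. -/
theorem cone_dichotomy {Z W Z' W' : ℝ → ℝ} {b k c B : ℝ} (hk : 0 ≤ k) (hkb : 4 * k ≤ b)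
    (hkc : k < c)
    (hW0 : ∀ t, 0 ≤ t → 0 ≤ W t)
    (hZ : ∀ t ∈ Ici (0 : ℝ), HasDerivWithinAt Z (Z' t) (Ici 0) t)
    (hW : ∀ t ∈ Ici (0 : ℝ), HasDerivWithinAt W (W' t) (Ici 0) t)
    (hZ' : ∀ t, 0 ≤ t → -k * (Z t + W t) ≤ Z' t)
    (hW' : ∀ t, 0 ≤ t → W' t ≤ -b * W t + k * (Z t + W t))
    (hdecay : ∀ t, 0 ≤ t → Z t ≤ B * Real.exp (-(2 * c) * t)) {t : ℝ} (ht : 0 ≤ t) :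
    Z t ≤ W t ∧ W t ≤ W 0 * Real.exp (-(b - 2 * k) * t) := by
  have hcone : ∀ s, 0 ≤ s → Z s ≤ W s := by
    intro s hs
    by_contra! hlt
    have hgrow : ∀ T, 0 ≤ T → (Z s - W s) * Real.exp (-(2 * k) * T) ≤ Z (s + T) - W (s + T) := by
      intro T hT
      have hsh : ∀ τ ∈ Icc 0 T, HasDerivWithinAt (fun τ => s + τ) 1 (Ici 0) τ := fun τ _ =>
        ((hasDerivAt_id τ).const_add s).hasDerivWithinAt
      have hmaps : MapsTo (fun τ => s + τ) (Ici (0 : ℝ)) (Ici 0) := fun τ hτ =>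
        add_nonneg hs hτ
      have := le_mul_exp_of_deriv_le (g := fun τ => W (s + τ) - Z (s + τ))
        (g' := fun τ => W' (s + τ) * 1 - Z' (s + τ) * 1) (a := 2 * k) hT
        (fun τ hτ => ((hW (s + τ) (hmaps hτ.1)).comp τ (hsh τ hτ) hmaps).sub
          ((hZ (s + τ) (hmaps hτ.1)).comp τ (hsh τ hτ) hmaps))
        (fun τ hτ => by
          have h0 := add_nonneg hs hτ.1
          have := hZ' _ h0
          have := hW' _ h0
          nlinarith [hW0 _ h0])
      simp only [add_zero] at this
      linarith
    have hlim : Tendsto (fun T : ℝ => B * Real.exp (-(2 * c) * s) *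
        Real.exp (-(2 * (c - k)) * T)) atTop (𝓝 0) := by
      have : Tendsto (fun T : ℝ => -(2 * (c - k)) * T) atTop atBot :=
        tendsto_id.const_mul_atTop_of_neg (by linarith)
      simpa using (Real.tendsto_exp_atBot.comp this).const_mul (B * Real.exp (-(2 * c) * s))
    refine absurd (ge_of_tendsto hlim (b := Z s - W s) ?_) (by linarith)
    filter_upwards [eventually_ge_atTop 0] with T hT
    have h1 := hgrow T hT
    have h2 := hdecay _ (add_nonneg hs hT)
    have h3 := hW0 _ (add_nonneg hs hT)
    have e1 : Real.exp (-(2 * c) * (s + T)) = Real.exp (-(2 * c) * s) *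
        Real.exp (-(2 * (c - k)) * T) * Real.exp (-(2 * k) * T) := by
      rw [← Real.exp_add, ← Real.exp_add]; ring_nf
    rw [e1] at h2
    refine le_of_mul_le_mul_right (a := Real.exp (-(2 * k) * T)) ?_ (Real.exp_pos _)
    linarith
  refine ⟨hcone t ht, le_mul_exp_of_deriv_le (g' := W') ht (fun τ hτ => hW τ hτ.1) fun τ hτ => ?_⟩
  nlinarith [hW' τ hτ.1, hcone τ hτ.1]

section
variable {E : Type*} [NormedAddCommGroup E] [InnerProductSpace ℝ E]

/-- A symmetric operator whose nonzero eigenvalues are at least `μ` is bounded below by `μ`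
on the orthogonal complement of its kernel. -/
theorem mul_norm_sq_le_inner_of_mem_ker_orthogonal [FiniteDimensional ℝ E] {H : E →L[ℝ] E}
    (hH : (H : E →ₗ[ℝ] E).IsSymmetric) {μ : ℝ}
    (hev : ∀ c : ℝ, c ≠ 0 → (∃ v, v ≠ 0 ∧ H v = c • v) → μ ≤ c)
    {q : E} (hq : q ∈ (LinearMap.ker (H : E →ₗ[ℝ] E))ᗮ) : μ * ‖q‖ ^ 2 ≤ ⟪H q, q⟫ := by
  set b := hH.eigenvectorBasis rfl
  have hb : ∀ i, H (b i) = hH.eigenvalues rfl i • b i := fun i => by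
    exact hH.apply_eigenvectorBasis rfl i
  have h1 : ⟪H q, q⟫ = ∑ i, hH.eigenvalues rfl i * ⟪b i, q⟫ ^ 2 := by
    rw [← b.sum_inner_mul_inner]
    refine Finset.sum_congr rfl fun i _ => ?_
    have : ⟪H q, b i⟫ = hH.eigenvalues rfl i * ⟪b i, q⟫ := by
      rw [show ⟪H q, b i⟫ = ⟪q, H (b i)⟫ from hH q (b i), hb, inner_smul_right, real_inner_comm]
    rw [this]; ring
  have h2 : ‖q‖ ^ 2 = ∑ i, ⟪b i, q⟫ ^ 2 := by
    rw [← b.sum_sq_norm_inner_right q]; simp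
  rw [h1, h2, Finset.mul_sum]
  refine Finset.sum_le_sum fun i _ => ?_
  by_cases h0 : hH.eigenvalues rfl i = 0
  · have : ⟪b i, q⟫ = 0 := hq (b i) (by simp [hb i, h0])
    simp [this]
  · have := hev _ h0 ⟨b i, b.orthonormal.ne_zero i, hb i⟩
    gcongr

set_option maxHeartbeats 1000000 in
/-- Exponential decay at nearly the rate `m` for a perturbation of the damped linear oscillator
with damping `2 m`, provided the solution is known to decay at some rate `c`. -/
theorem perturbed_oscillator_decay [FiniteDimensional ℝ E] {H : E →L[ℝ] E}
    (hH : (H : E →ₗ[ℝ] E).IsSymmetric) {m M ε η c B : ℝ} (hm : 0 < m) (hε : 0 < ε) (hεm : ε < m)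
    (hη : 0 ≤ η) (hM : ‖H‖ ≤ M)
    (hev : ∀ c : ℝ, c ≠ 0 → (∃ v, v ≠ 0 ∧ H v = c • v) → m ^ 2 ≤ c)
    (hηε : 12 * η * (1 / (2 * m) + 1 / ε) ≤ ε / 2) (hηc : 6 * η * (1 / (2 * m) + 1 / ε) < c)
    {y v r : ℝ → E}
    (hy : ∀ t ∈ Ici (0 : ℝ), HasDerivWithinAt y (v t) (Ici 0) t)
    (hv : ∀ t ∈ Ici (0 : ℝ),
      HasDerivWithinAt v (-((2 * m) • v t) - (H (y t) + r t)) (Ici 0) t)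
    (hr : ∀ t, 0 ≤ t → ‖r t‖ ≤ η * ‖y t‖)
    (hyB : ∀ t, 0 ≤ t → ‖y t‖ ≤ B * Real.exp (-c * t))
    (hvB : ∀ t, 0 ≤ t → ‖v t‖ ≤ B * Real.exp (-c * t)) {t : ℝ} (ht : 0 ≤ t) :
    ‖y t‖ ≤ 2 * (1 / (2 * m) + 1 / ε) * ((1 + m) + M + ε + 1) * (‖y 0‖ + ‖v 0‖) *
      Real.exp (-(m - ε) * t) := by
  set K := 1 / (2 * m) + 1 / ε with hK
  have hKpos : 0 < K := by positivity
  set P := (LinearMap.ker (H : E →ₗ[ℝ] E)).starProjection with hP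
  have hHP : ∀ w, H (P w) = 0 := fun w => by
    exact Submodule.starProjection_apply_mem (LinearMap.ker (H : E →ₗ[ℝ] E)) w
  have hPH : ∀ w, P (H w) = 0 := fun w => by
    rw [hP, Submodule.starProjection_apply_eq_zero_iff]
    intro k hk
    have : ⟪H k, w⟫ = ⟪k, H w⟫ := hH k w
    rw [← this, show H k = 0 from hk, inner_zero_left]
  have hPn : ∀ w, ‖P w‖ ≤ ‖w‖ := fun w => Submodule.norm_starProjection_apply_le _ w
  have hQn : ∀ w, ‖w - P w‖ ≤ ‖w‖ := fun w => by
    have := Submodule.norm_starProjection_apply_le (LinearMap.ker (H : E →ₗ[ℝ] E))ᗮ w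
    rwa [Submodule.starProjection_orthogonal_val] at this
  set p : ℝ → E := fun t => P (v t) with hp
  set z : ℝ → E := fun t => (2 * m) • P (y t) + P (v t) with hz
  set q : ℝ → E := fun t => y t - P (y t) with hq
  set u : ℝ → E := fun t => (v t - P (v t)) + m • q t with hu
  have hq_mem : ∀ t, m ^ 2 * ‖q t‖ ^ 2 ≤ ⟪H (q t), q t⟫ := fun t =>
    mul_norm_sq_le_inner_of_mem_ker_orthogonal hH hev
      (Submodule.sub_starProjection_mem_orthogonal _)
  have dPy : ∀ t ∈ Ici (0 : ℝ), HasDerivWithinAt (fun t => P (y t)) (P (v t)) (Ici 0) t :=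
    fun t ht => P.hasFDerivAt.comp_hasDerivWithinAt t (hy t ht)
  have dp : ∀ t ∈ Ici (0 : ℝ), HasDerivWithinAt p (-((2 * m) • p t) - P (r t)) (Ici 0) t :=
    fun t ht => by
      have := P.hasFDerivAt.comp_hasDerivWithinAt t (hv t ht)
      refine this.congr_deriv ?_
      simp [hPH, hp]
  have dz : ∀ t ∈ Ici (0 : ℝ), HasDerivWithinAt z (-P (r t)) (Ici 0) t := fun t ht => by
    refine (((dPy t ht).const_smul (2 * m)).add (dp t ht)).congr_deriv ?_
    simp only [hp]
    abel
  have dq : ∀ t ∈ Ici (0 : ℝ), HasDerivWithinAt q (u t - m • q t) (Ici 0) t := fun t ht => by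
    refine ((hy t ht).sub (dPy t ht)).congr_deriv ?_
    simp [hu]
  have du : ∀ t ∈ Ici (0 : ℝ), HasDerivWithinAt u
      (-(m • u t) + m ^ 2 • q t - H (q t) - (r t - P (r t))) (Ici 0) t := fun t ht => by
    refine (((hv t ht).sub (dp t ht)).add ((dq t ht).const_smul m)).congr_deriv ?_
    simp only [hp, hu, hq, map_sub, hHP]
    module
  have dHq : ∀ t ∈ Ici (0 : ℝ), HasDerivWithinAt (fun t => H (q t)) (H (u t - m • q t)) (Ici 0) t :=
    fun t ht => H.hasFDerivAt.comp_hasDerivWithinAt t (dq t ht)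
  set W : ℝ → ℝ := fun t => ⟪u t, u t⟫ + ⟪H (q t), q t⟫ + (ε ^ 2 - m ^ 2) * ⟪q t, q t⟫
    + ⟪p t, p t⟫ with hW
  set Z : ℝ → ℝ := fun t => ⟪z t, z t⟫ with hZ
  have hWlow : ∀ t, ‖u t‖ ^ 2 + ε ^ 2 * ‖q t‖ ^ 2 + ‖p t‖ ^ 2 ≤ W t := fun t => by
    simp only [hW, real_inner_self_eq_norm_sq]
    linarith [hq_mem t]
  have hWnn : ∀ t, 0 ≤ W t := fun t => le_trans (by positivity) (hWlow t)
  have hsq : ∀ t, Real.sqrt (W t) ^ 2 = W t := fun t => Real.sq_sqrt (hWnn t)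
  have hun : ∀ t, ‖u t‖ ≤ Real.sqrt (W t) := fun t =>
    Real.le_sqrt_of_sq_le (by nlinarith [hWlow t, sq_nonneg (ε * ‖q t‖), sq_nonneg ‖p t‖])
  have hpn : ∀ t, ‖p t‖ ≤ Real.sqrt (W t) := fun t =>
    Real.le_sqrt_of_sq_le (by nlinarith [hWlow t, sq_nonneg (ε * ‖q t‖), sq_nonneg ‖u t‖])
  have hqn : ∀ t, ε * ‖q t‖ ≤ Real.sqrt (W t) := fun t =>
    Real.le_sqrt_of_sq_le (by nlinarith [hWlow t, sq_nonneg ‖u t‖, sq_nonneg ‖p t‖])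
  have hyn : ∀ t, ‖y t‖ ≤ K * (‖z t‖ + Real.sqrt (W t)) := fun t => by
    have e : y t = (1 / (2 * m)) • (z t - p t) + q t := by
      simp only [hz, hp, hq, add_sub_cancel_right, smul_smul]
      rw [one_div_mul_cancel (by positivity)]
      simp
    have h1 : ‖q t‖ ≤ 1 / ε * Real.sqrt (W t) := by
      rw [one_div, inv_mul_eq_div, le_div_iff₀ hε, mul_comm]; exact hqn t
    calc ‖y t‖ ≤ ‖(1 / (2 * m)) • (z t - p t)‖ + ‖q t‖ := by
          conv_lhs => rw [e]
          exact norm_add_le _ _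
      _ = 1 / (2 * m) * ‖z t - p t‖ + ‖q t‖ := by
          rw [norm_smul, Real.norm_of_nonneg (by positivity)]
      _ ≤ 1 / (2 * m) * (‖z t‖ + Real.sqrt (W t)) + 1 / ε * (‖z t‖ + Real.sqrt (W t)) := by
          gcongr
          · exact (norm_sub_le _ _).trans (by linarith [hpn t])
          · exact h1.trans (by gcongr; linarith [norm_nonneg (z t)])
      _ = _ := by rw [hK]; ring
  have hrn : ∀ t, 0 ≤ t → ‖r t‖ ≤ η * K * (‖z t‖ + Real.sqrt (W t)) := fun t ht =>
    (hr t ht).trans (by rw [mul_assoc]; gcongr; exact hyn t)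
  have hηK : 0 ≤ η * K := by positivity
  have key := cone_dichotomy (Z := Z) (W := W) (b := 2 * m - ε) (k := 6 * η * K) (c := c)
    (B := ((2 * m + 1) * B) ^ 2) (by positivity) (by linarith) hηc (fun t _ => hWnn t)
    (fun t ht => (dz t ht).inner ℝ (dz t ht))
    (fun t ht => ((((du t ht).inner ℝ (du t ht)).add ((dHq t ht).inner ℝ (dq t ht))).add
      (((dq t ht).inner ℝ (dq t ht)).const_mul _)).add ((dp t ht).inner ℝ (dp t ht)))
    (fun t ht => by
      have h1 : ⟪z t, P (r t)⟫ ≤ ‖z t‖ * (η * K * (‖z t‖ + Real.sqrt (W t))) :=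
        (real_inner_le_norm _ _).trans (by gcongr; exact (hPn _).trans (hrn t ht))
      have h2 : ‖z t‖ * (‖z t‖ + Real.sqrt (W t)) ≤ 3 * (‖z t‖ ^ 2 + W t) := by
        nlinarith [sq_nonneg (‖z t‖ - Real.sqrt (W t)), hsq t, sq_nonneg ‖z t‖, hWnn t]
      have h3 := mul_le_mul_of_nonneg_left h2 hηK
      simp only [hZ, inner_neg_right, inner_neg_left, real_inner_self_eq_norm_sq]
      rw [real_inner_comm (z t) (P (r t))]
      linarith)
    (fun t ht => by
      have hS := hrn t ht
      have h1 : -⟪u t, r t - P (r t)⟫ ≤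
          Real.sqrt (W t) * (η * K * (‖z t‖ + Real.sqrt (W t))) := by
        rw [← inner_neg_right]
        refine (real_inner_le_norm _ _).trans ?_
        rw [norm_neg]
        gcongr
        · exact hun t
        · exact (hQn _).trans hS
      have h2 : -⟪p t, P (r t)⟫ ≤
          Real.sqrt (W t) * (η * K * (‖z t‖ + Real.sqrt (W t))) := by
        rw [← inner_neg_right]
        refine (real_inner_le_norm _ _).trans ?_
        rw [norm_neg]
        gcongr
        · exact hpn t
        · exact (hPn _).trans hS
      have h3 : Real.sqrt (W t) * (‖z t‖ + Real.sqrt (W t)) ≤ 3 / 2 * (‖z t‖ ^ 2 + W t) := by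
        nlinarith [sq_nonneg (‖z t‖ - Real.sqrt (W t)), hsq t, sq_nonneg ‖z t‖, hWnn t]
      have h4 := mul_le_mul_of_nonneg_left h3 hηK
      have h5 : 2 * (ε * ⟪u t, q t⟫) ≤ ε ^ 2 * ‖q t‖ ^ 2 + ‖u t‖ ^ 2 := by
        have := mul_le_mul_of_nonneg_left (real_inner_le_norm (u t) (q t)) hε.le
        nlinarith [sq_nonneg (ε * ‖q t‖ - ‖u t‖)]
      have h6 := mul_le_mul_of_nonneg_left h5 hε.le
      have h7 : ⟪H (u t), q t⟫ = ⟪u t, H (q t)⟫ := hH (u t) (q t)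
      have h8 := mul_le_mul_of_nonneg_left (hq_mem t) hε.le
      have h9 := mul_nonneg hm.le (sq_nonneg ‖p t‖)
      have h10 := mul_nonneg hε.le (sq_nonneg ‖p t‖)
      simp only [hW, hZ, inner_add_left, inner_add_right, inner_sub_left, inner_sub_right,
        inner_neg_left, inner_neg_right, real_inner_smul_left, real_inner_smul_right, map_sub,
        map_smul, h7] at h1 h2 h3 h4 ⊢
      rw [real_inner_comm (u t) (q t), real_inner_comm (u t) (H (q t)),
        real_inner_comm (u t) (r t), real_inner_comm (u t) (P (r t)),
        real_inner_comm (p t) (P (r t))]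
      simp only [real_inner_self_eq_norm_sq] at h1 h2 h3 h4 ⊢
      linarith)
    (fun t ht => by
      have h1 : ‖z t‖ ≤ (2 * m + 1) * B * Real.exp (-c * t) := by
        calc ‖z t‖ ≤ ‖(2 * m) • P (y t)‖ + ‖P (v t)‖ := norm_add_le _ _
          _ ≤ 2 * m * ‖y t‖ + ‖v t‖ := by
            rw [norm_smul, Real.norm_of_nonneg (by positivity)]
            gcongr
            · exact hPn _
            · exact hPn _
          _ ≤ 2 * m * (B * Real.exp (-c * t)) + B * Real.exp (-c * t) := by
            gcongr
            · exact hyB t ht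
            · exact hvB t ht
          _ = _ := by ring
      have h2 : Real.exp (-(2 * c) * t) = Real.exp (-c * t) ^ 2 := by
        rw [← Real.exp_nat_mul]; push_cast; ring_nf
      rw [h2, ← mul_pow]
      simp only [hZ, real_inner_self_eq_norm_sq]
      gcongr) ht
  obtain ⟨hZW, hWt⟩ := key
  set A := (1 + m) + M + ε + 1 with hA
  have hMnn : 0 ≤ M := (norm_nonneg _).trans hM
  have hW0 : W 0 ≤ (A * (‖y 0‖ + ‖v 0‖)) ^ 2 := by
    set S := ‖y 0‖ + ‖v 0‖ with hS
    have hy0 : ‖y 0‖ ≤ S := by simp [hS]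
    have hv0 : ‖v 0‖ ≤ S := by simp [hS]
    have hS0 : 0 ≤ S := by positivity
    have hq0 : ‖q 0‖ ≤ S := (hQn _).trans hy0
    have hp0 : ‖p 0‖ ≤ S := (hPn _).trans hv0
    have hu0 : ‖u 0‖ ≤ (1 + m) * S := by
      calc ‖u 0‖ ≤ ‖v 0 - P (v 0)‖ + ‖m • q 0‖ := norm_add_le _ _
        _ ≤ S + m * S := by
          rw [norm_smul, Real.norm_of_nonneg hm.le]
          gcongr
          exact (hQn _).trans hv0
        _ = _ := by ring
    have hHq : ⟪H (q 0), q 0⟫ ≤ M * S ^ 2 := by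
      calc ⟪H (q 0), q 0⟫ ≤ ‖H (q 0)‖ * ‖q 0‖ := real_inner_le_norm _ _
        _ ≤ (M * ‖q 0‖) * ‖q 0‖ := by gcongr; exact H.le_of_opNorm_le hM _
        _ ≤ (M * S) * S := by gcongr
        _ = _ := by ring
    have h1 : W 0 ≤ ((1 + m) * S) ^ 2 + M * S ^ 2 + ε ^ 2 * S ^ 2 + S ^ 2 := by
      simp only [hW, real_inner_self_eq_norm_sq, sub_mul]
      have : 0 ≤ m ^ 2 * ‖q 0‖ ^ 2 := by positivity
      have : ε ^ 2 * ‖q 0‖ ^ 2 ≤ ε ^ 2 * S ^ 2 := by gcongr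
      have : ‖u 0‖ ^ 2 ≤ ((1 + m) * S) ^ 2 := by gcongr
      have : ‖p 0‖ ^ 2 ≤ S ^ 2 := by gcongr
      linarith
    have h2 : (1 + m) ^ 2 + M + ε ^ 2 + 1 ≤ A ^ 2 := by
      rw [hA]; nlinarith [mul_nonneg hm.le hMnn, mul_nonneg hε.le hMnn, mul_pos hε hm]
    nlinarith [mul_le_mul_of_nonneg_right h2 (sq_nonneg S)]
  have hA0 : 0 ≤ A * (‖y 0‖ + ‖v 0‖) := by positivity
  have hsW : Real.sqrt (W t) ≤ A * (‖y 0‖ + ‖v 0‖) * Real.exp (-(m - ε) * t) := by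
    rw [Real.sqrt_le_left (by positivity)]
    have h2 : Real.exp (-(m - ε) * t) ^ 2 = Real.exp (-(2 * m - 2 * ε) * t) := by
      rw [← Real.exp_nat_mul]; push_cast; ring_nf
    rw [mul_pow, h2]
    refine hWt.trans (mul_le_mul hW0 (Real.exp_le_exp.2 ?_) (Real.exp_pos _).le (sq_nonneg _))
    exact mul_le_mul_of_nonneg_right (by linarith) ht
  have hzW : ‖z t‖ ≤ Real.sqrt (W t) :=
    Real.le_sqrt_of_sq_le (by simpa only [hZ, real_inner_self_eq_norm_sq] using hZW)
  calc ‖y t‖ ≤ K * (‖z t‖ + Real.sqrt (W t)) := hyn t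
    _ ≤ K * (2 * (A * (‖y 0‖ + ‖v 0‖) * Real.exp (-(m - ε) * t))) := by
      gcongr; linarith
    _ = _ := by ring
/-- A curve with exponentially small speed moves by an exponentially small amount. -/
theorem norm_sub_le_of_norm_deriv_le_exp {x v : ℝ → E} {B c s T : ℝ} (hc : 0 < c) (hs : 0 ≤ s)
    (hsT : s ≤ T) (hx : ∀ t ∈ Ici (0 : ℝ), HasDerivWithinAt x (v t) (Ici 0) t)
    (hv : ∀ t ∈ Ico s T, ‖v t‖ ≤ B * Real.exp (-c * t)) :
    ‖x T - x s‖ ≤ B / c * (Real.exp (-c * s) - Real.exp (-c * T)) := by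
  have hB : ∀ t : ℝ, HasDerivAt (fun t => B / c * (Real.exp (-c * s) - Real.exp (-c * t)))
      (B * Real.exp (-c * t)) t := fun t => by
    have := ((((hasDerivAt_id t).const_mul (-c)).exp.const_sub (Real.exp (-c * s))).const_mul
      (B / c))
    refine this.congr_deriv ?_
    simp only [id]
    field_simp
  refine image_norm_le_of_norm_deriv_right_le_deriv_boundary (f := fun t => x t - x s) (f' := v)
    (fun t ht => ?_) (fun t ht => ?_) (by simp) hB hv (right_mem_Icc.2 hsT)
  · exact ((hx t (hs.trans ht.1)).sub_const _).continuousWithinAt.mono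
      (Icc_subset_Ici_self.trans (Ici_subset_Ici.2 hs))
  · exact ((hx t (hs.trans ht.1)).sub_const _).mono (Ici_subset_Ici.2 (hs.trans ht.1))

theorem exists_limit_of_norm_deriv_le_exp [CompleteSpace E] {x v : ℝ → E} {B c : ℝ} (hc : 0 < c)
    (hx : ∀ t ∈ Ici (0 : ℝ), HasDerivWithinAt x (v t) (Ici 0) t)
    (hv : ∀ t, 0 ≤ t → ‖v t‖ ≤ B * Real.exp (-c * t)) :
    ∃ x', ∀ t, 0 ≤ t → ‖x t - x'‖ ≤ B / c * Real.exp (-c * t) := by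
  have hB : 0 ≤ B := by simpa using (norm_nonneg _).trans (hv 0 le_rfl)
  have hmove : ∀ s t, 0 ≤ s → s ≤ t → ‖x t - x s‖ ≤ B / c * Real.exp (-c * s) := fun s t hs hst =>
    (norm_sub_le_of_norm_deriv_le_exp hc hs hst hx fun τ hτ => hv τ (hs.trans hτ.1)).trans (by
      gcongr
      linarith [Real.exp_pos (-c * t)])
  have hlim : Tendsto (fun n : ℕ => 2 * (B / c * Real.exp (-c * n))) atTop (𝓝 0) := by
    have h1 : Tendsto (fun n : ℕ => -c * (n : ℝ)) atTop atBot :=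
      tendsto_natCast_atTop_atTop.const_mul_atTop_of_neg (by linarith)
    simpa using ((Real.tendsto_exp_atBot.comp h1).const_mul (B / c)).const_mul 2
  have hcauchy : CauchySeq fun n : ℕ => x n := by
    refine cauchySeq_of_le_tendsto_0 _ (fun n m N hn hm => ?_) hlim
    rw [dist_eq_norm]
    have h1 := hmove N n (Nat.cast_nonneg _) (Nat.cast_le.2 hn)
    have h2 := hmove N m (Nat.cast_nonneg _) (Nat.cast_le.2 hm)
    calc ‖x n - x m‖ = ‖(x n - x N) - (x m - x N)‖ := by congr 1; abel
      _ ≤ ‖x n - x N‖ + ‖x m - x N‖ := norm_sub_le _ _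
      _ ≤ _ := by linarith
  obtain ⟨x', hx'⟩ := cauchySeq_tendsto_of_complete hcauchy
  refine ⟨x', fun t ht => ?_⟩
  have h1 : Tendsto (fun n : ℕ => ‖x t - x n‖) atTop (𝓝 ‖x t - x'‖) := (hx'.const_sub _).norm
  refine le_of_tendsto h1 ?_
  filter_upwards [tendsto_natCast_atTop_atTop.eventually_ge_atTop t] with n hn
  rw [norm_sub_rev]
  exact hmove t n ht hn

/-- The cross term `a ⟪g, v⟫` is controlled by half of the energy `F + ‖v‖ ^ 2 / 2`. -/
theorem abs_crossTerm_le {F a M : ℝ} {g v : E} (ha : 0 ≤ a) (haM : 4 * M * a ≤ 1)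
    (ha2 : a ≤ 1 / 2) (hF : 0 ≤ F) (hg : ‖g‖ ^ 2 ≤ 4 * M * F) :
    |a * ⟪g, v⟫| ≤ 1 / 2 * F + 1 / 4 * ‖v‖ ^ 2 := by
  rw [abs_mul, abs_of_nonneg ha]
  have h1 := mul_le_mul_of_nonneg_left (abs_real_inner_le_norm g v) ha
  have h2 : ‖g‖ * ‖v‖ ≤ 1 / 2 * (‖g‖ ^ 2 + ‖v‖ ^ 2) := by nlinarith [sq_nonneg (‖g‖ - ‖v‖)]
  have h3 := mul_le_mul_of_nonneg_left h2 ha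
  have h4 := mul_le_mul_of_nonneg_left hg ha
  have h5 := mul_le_mul_of_nonneg_right haM hF
  have h6 := mul_le_mul_of_nonneg_right ha2 (sq_nonneg ‖v‖)
  linarith

/-- The dissipation inequality for the energy with cross term, at a single point. -/
theorem crossEnergy_deriv_le {F a M γ ν c : ℝ} {G : E →L[ℝ] E} {g v : E} (ha : 0 ≤ a)
    (haM : 4 * M * a ≤ 1) (ha2 : a ≤ 1 / 2) (haγ : a * (2 * M + γ ^ 2) ≤ γ) (hF : 0 ≤ F)
    (hg : ‖g‖ ^ 2 ≤ 4 * M * F) (hPL : 2 * ν * F ≤ ‖g‖ ^ 2) (hG : ‖G‖ ≤ M) (hc : 0 ≤ c)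
    (hcγ : 3 * c ≤ γ) (hcν : 3 * c ≤ a * ν) :
    ⟪g, v⟫ + ⟪v, -(γ • v) - g⟫ + a * (⟪g, -(γ • v) - g⟫ + ⟪G v, v⟫) ≤
      -(2 * c) * (F + 1 / 2 * ‖v‖ ^ 2 + a * ⟪g, v⟫) := by
  have hcross := abs_le.1 (abs_crossTerm_le (v := v) ha haM ha2 hF hg)
  have hGv : ⟪G v, v⟫ ≤ M * ‖v‖ ^ 2 := by
    calc ⟪G v, v⟫ ≤ ‖G v‖ * ‖v‖ := real_inner_le_norm _ _
      _ ≤ M * ‖v‖ * ‖v‖ := by gcongr; exact G.le_of_opNorm_le hG v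
      _ = _ := by ring
  have hγg : -(γ * ⟪g, v⟫) ≤ 1 / 2 * ‖g‖ ^ 2 + 1 / 2 * (γ ^ 2 * ‖v‖ ^ 2) := by
    have h1 := abs_le.1 (abs_real_inner_le_norm g v)
    have hγ : 0 ≤ γ := by linarith
    have h2 := mul_le_mul_of_nonneg_left h1.1 hγ
    nlinarith [sq_nonneg (‖g‖ - γ * ‖v‖)]
  have h1 := mul_le_mul_of_nonneg_left hGv ha
  have h2 := mul_le_mul_of_nonneg_left hγg ha
  have h3 := mul_le_mul_of_nonneg_right haγ (sq_nonneg ‖v‖)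
  have h4 := mul_le_mul_of_nonneg_left hPL ha
  have h5 := mul_le_mul_of_nonneg_right hcγ (sq_nonneg ‖v‖)
  have h6 := mul_le_mul_of_nonneg_right hcν hF
  have h7 := mul_le_mul_of_nonneg_left hcross.2 hc
  simp only [inner_sub_right, inner_neg_right, real_inner_smul_right, real_inner_self_eq_norm_sq]
  rw [real_inner_comm g v]
  linarith

variable [CompleteSpace E]

theorem contDiff_gradient {f : E → ℝ} (hf : ContDiff ℝ 2 f) : ContDiff ℝ 1 (gradient f) :=
  (InnerProductSpace.toDual ℝ E).symm.contDiff.comp (hf.fderiv_right (by norm_num))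

theorem inner_fderiv_gradient {f : E → ℝ} (hf : ContDiff ℝ 2 f) (p u w : E) :
    ⟪fderiv ℝ (gradient f) p u, w⟫ = fderiv ℝ (fderiv ℝ f) p u w := by
  have h1 : HasFDerivAt (gradient f) (fderiv ℝ (gradient f) p) p :=
    ((contDiff_gradient hf).differentiable (by norm_num) p).hasFDerivAt
  have h2 : HasFDerivAt (fderiv ℝ f)
      (((InnerProductSpace.toDualMap ℝ E).toContinuousLinearMap).comp
        (fderiv ℝ (gradient f) p)) p := by
    have := ((InnerProductSpace.toDualMap ℝ E).toContinuousLinearMap).hasFDerivAt.comp p h1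
    refine this.congr_of_eventuallyEq (Eventually.of_forall fun z => ?_)
    exact (toDual_gradient (𝕜 := ℝ) (f := f) (x := z)).symm
  rw [h2.fderiv]
  rfl

theorem isSymmetric_fderiv_gradient {f : E → ℝ} (hf : ContDiff ℝ 2 f) (p : E) :
    ((fderiv ℝ (gradient f) p : E →L[ℝ] E) : E →ₗ[ℝ] E).IsSymmetric := fun u w => by
  have h := (hf.contDiffAt (x := p)).isSymmSndFDerivAt (by simp) u w
  calc ⟪fderiv ℝ (gradient f) p u, w⟫ = fderiv ℝ (fderiv ℝ f) p u w := inner_fderiv_gradient hf ..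
    _ = fderiv ℝ (fderiv ℝ f) p w u := h
    _ = ⟪fderiv ℝ (gradient f) p w, u⟫ := (inner_fderiv_gradient hf ..).symm
    _ = _ := real_inner_comm _ _

/-- Near a minimizer the squared gradient norm is controlled by the excess of the function. -/
theorem norm_gradient_sq_le {f : E → ℝ} (hf : ContDiff ℝ 2 f) {xs : E} {r M : ℝ} (hM : 0 < M)
    (hcrit : gradient f xs = 0) (hmin : ∀ x ∈ Metric.ball xs (2 * r), f xs ≤ f x)
    (hHess : ∀ x ∈ Metric.ball xs (2 * r), ‖fderiv ℝ (gradient f) x‖ ≤ M)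
    {x : E} (hx : x ∈ Metric.ball xs r) : ‖gradient f x‖ ^ 2 ≤ 4 * M * (f x - f xs) := by
  have hr : 0 < r := Metric.pos_of_mem_ball hx
  have hdg : ∀ y, DifferentiableAt ℝ (gradient f) y := fun y =>
    (contDiff_gradient hf).differentiable (by norm_num) y
  have hdf : ∀ y, DifferentiableAt ℝ f y := fun y => hf.differentiable (by norm_num) y
  have hsub : Metric.ball xs r ⊆ Metric.ball xs (2 * r) := Metric.ball_subset_ball (by linarith)
  have hLip : ∀ y ∈ Metric.ball xs (2 * r), ∀ z ∈ Metric.ball xs (2 * r),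
      ‖gradient f z - gradient f y‖ ≤ M * ‖z - y‖ := fun y hy z hz =>
    (convex_ball xs (2 * r)).norm_image_sub_le_of_norm_fderiv_le (fun w _ => hdg w) hHess hy hz
  set g := gradient f x with hg
  have hgr : ‖g‖ ≤ M * ‖x - xs‖ := by
    have := hLip xs (Metric.mem_ball_self (by linarith)) x (hsub hx)
    rwa [hcrit, sub_zero] at this
  rw [mem_ball_iff_norm] at hx
  set h : E := -((1 / (2 * M)) • g) with hh
  have hhn : ‖h‖ = 1 / (2 * M) * ‖g‖ := by
    rw [hh, norm_neg, norm_smul, Real.norm_of_nonneg (by positivity)]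
  have hhr : ‖h‖ ≤ r / 2 := by
    rw [hhn]
    calc 1 / (2 * M) * ‖g‖ ≤ 1 / (2 * M) * (M * r) := by
          gcongr; exact hgr.trans (by gcongr)
      _ = r / 2 := by field_simp
  have hseg : segment ℝ x (x + h) ⊆ Metric.ball xs (2 * r) := by
    refine (convex_ball xs (2 * r)).segment_subset (hsub (mem_ball_iff_norm.2 hx)) ?_
    rw [mem_ball_iff_norm, add_sub_right_comm]
    exact (norm_add_le _ _).trans_lt (by linarith)
  have hdesc := (convex_segment x (x + h)).norm_image_sub_le_of_norm_fderiv_le' (𝕜 := ℝ) (f := f)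
    (φ := fderiv ℝ f x) (C := M * ‖h‖) (fun y _ => hdf y) (fun y hy => by
      have h1 : ‖fderiv ℝ f y - fderiv ℝ f x‖ = ‖gradient f y - g‖ := by
        rw [hg, ← toDual_gradient, ← toDual_gradient, ← map_sub, LinearIsometryEquiv.norm_map]
      rw [h1]
      refine (hLip x (hseg (left_mem_segment ℝ _ _)) y (hseg hy)).trans ?_
      gcongr
      simpa using norm_sub_le_of_mem_segment hy)
    (left_mem_segment ℝ _ _) (right_mem_segment ℝ _ _)
  have hlin : fderiv ℝ f x h = -(1 / (2 * M) * ‖g‖ ^ 2) := by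
    rw [← inner_gradient_left (𝕜 := ℝ), hh, inner_neg_right, real_inner_smul_right,
      real_inner_self_eq_norm_sq]
  rw [add_sub_cancel_left, hlin, hhn, Real.norm_eq_abs] at hdesc
  have h2 := (le_abs_self _).trans hdesc
  have h3 := hmin _ (hseg (right_mem_segment ℝ _ _))
  have h4 : M * (1 / (2 * M) * ‖g‖) * (1 / (2 * M) * ‖g‖) = 1 / (4 * M) * ‖g‖ ^ 2 := by
    field_simp; ring
  have h5 : 1 / (2 * M) * ‖g‖ ^ 2 = 2 * (1 / (4 * M) * ‖g‖ ^ 2) := by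
    field_simp; ring
  have h6 : 1 / (4 * M) * ‖g‖ ^ 2 ≤ f x - f xs := by linarith
  rw [one_div, inv_mul_eq_div, div_le_iff₀ (by positivity)] at h6
  linarith

/-- The total energy with a cross term, a strict Lyapunov function for the Heavy Ball flow. -/
noncomputable def crossEnergy (f : E → ℝ) (xs : E) (a : ℝ) (x v : E) : ℝ :=
  (f x - f xs) + 1 / 2 * ‖v‖ ^ 2 + a * ⟪gradient f x, v⟫

/-- A Heavy Ball trajectory starting near `xs` with small energy stays near `xs` and its energy
decays exponentially. -/
theorem heavyBall_mem_ball_and_decay {f : E → ℝ} (hf : ContDiff ℝ 2 f) {xs : E}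
    {r a M γ ν c : ℝ} (ha : 0 ≤ a) (haM : 4 * M * a ≤ 1) (ha2 : a ≤ 1 / 2)
    (haγ : a * (2 * M + γ ^ 2) ≤ γ) (hc : 0 < c) (hcγ : 3 * c ≤ γ) (hcν : 3 * c ≤ a * ν)
    (hmin : ∀ x ∈ Metric.ball xs r, f xs ≤ f x)
    (hg : ∀ x ∈ Metric.ball xs r, ‖gradient f x‖ ^ 2 ≤ 4 * M * (f x - f xs))
    (hPL : ∀ x ∈ Metric.ball xs r, 2 * ν * (f x - f xs) ≤ ‖gradient f x‖ ^ 2)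
    (hG : ∀ x ∈ Metric.ball xs r, ‖fderiv ℝ (gradient f) x‖ ≤ M) {x v : ℝ → E}
    (hx : ∀ t ∈ Ici (0 : ℝ), HasDerivWithinAt x (v t) (Ici 0) t)
    (hv : ∀ t ∈ Ici (0 : ℝ), HasDerivWithinAt v (-(γ • v t) - gradient f (x t)) (Ici 0) t)
    (hx0 : ‖x 0 - xs‖ < r / 2)
    (hV0 : 2 * Real.sqrt (crossEnergy f xs a (x 0) (v 0)) / c < r / 2) (t : ℝ) (ht : 0 ≤ t) :
    x t ∈ Metric.ball xs r ∧
    ‖v t‖ ≤ 2 * Real.sqrt (crossEnergy f xs a (x 0) (v 0)) * Real.exp (-c * t) ∧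
    f (x t) - f xs ≤ 2 * (crossEnergy f xs a (x 0) (v 0) * Real.exp (-(2 * c) * t)) := by
  set V : ℝ → ℝ := fun t => crossEnergy f xs a (x t) (v t) with hV
  change _ ∧ ‖v t‖ ≤ 2 * Real.sqrt (V 0) * _ ∧ _ ≤ 2 * (V 0 * _)
  change 2 * Real.sqrt (V 0) / c < _ at hV0
  have hVd : ∀ t ∈ Ici (0 : ℝ), HasDerivWithinAt V
      (⟪gradient f (x t), v t⟫ + ⟪v t, -(γ • v t) - gradient f (x t)⟫ +
        a * (⟪gradient f (x t), -(γ • v t) - gradient f (x t)⟫ +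
          ⟪fderiv ℝ (gradient f) (x t) (v t), v t⟫)) (Ici 0) t := fun t ht => by
    have h1 : HasDerivWithinAt (fun t => f (x t)) (fderiv ℝ f (x t) (v t)) (Ici 0) t :=
      (hf.differentiable (by norm_num) (x t)).hasFDerivAt.comp_hasDerivWithinAt t (hx t ht)
    have h2 : HasDerivWithinAt (fun t => gradient f (x t))
        (fderiv ℝ (gradient f) (x t) (v t)) (Ici 0) t :=
      ((contDiff_gradient hf).differentiable (by norm_num)
        (x t)).hasFDerivAt.comp_hasDerivWithinAt t (hx t ht)
    have h3 := ((h1.sub_const (f xs)).add ((hv t ht).norm_sq.const_mul (1 / 2))).add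
      ((h2.inner ℝ (hv t ht)).const_mul a)
    refine h3.congr_deriv ?_
    rw [← inner_gradient_left (𝕜 := ℝ)]
    ring
  have henergy : ∀ t, x t ∈ Metric.ball xs r →
      (f (x t) - f xs) + 1 / 2 * ‖v t‖ ^ 2 ≤ 2 * V t := fun t hxt => by
    have := abs_le.1 (abs_crossTerm_le (v := v t) ha haM ha2 (sub_nonneg.2 (hmin _ hxt))
      (hg _ hxt))
    simp only [hV, crossEnergy]
    linarith
  have hdecay : ∀ t, 0 ≤ t → (∀ τ ∈ Icc 0 t, x τ ∈ Metric.ball xs r) →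
      V t ≤ V 0 * Real.exp (-(2 * c) * t) := fun t ht hball =>
    le_mul_exp_of_deriv_le ht (fun τ hτ => hVd τ hτ.1) fun τ hτ => by
      have hτ' := hball τ (Ico_subset_Icc_self hτ)
      exact crossEnergy_deriv_le ha haM ha2 haγ (sub_nonneg.2 (hmin _ hτ')) (hg _ hτ')
        (hPL _ hτ') (hG _ hτ') hc.le hcγ hcν
  have hr : 0 < r := by linarith [norm_nonneg (x 0 - xs)]
  have hx0' : x 0 ∈ Metric.ball xs r := by rw [mem_ball_iff_norm]; linarith
  have hV0nn : 0 ≤ V 0 := by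
    nlinarith [henergy 0 hx0', hmin _ hx0', sq_nonneg ‖v 0‖]
  have hspeed : ∀ t, 0 ≤ t → (∀ τ ∈ Icc 0 t, x τ ∈ Metric.ball xs r) →
      ‖v t‖ ≤ 2 * Real.sqrt (V 0) * Real.exp (-c * t) := fun t ht hball => by
    have h1 := henergy t (hball t (right_mem_Icc.2 ht))
    have h2 := hdecay t ht hball
    have h3 := hmin _ (hball t (right_mem_Icc.2 ht))
    refine (pow_le_pow_iff_left₀ (norm_nonneg _) (by positivity) two_ne_zero).1 ?_
    have h4 : Real.exp (-c * t) ^ 2 = Real.exp (-(2 * c) * t) := by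
      rw [← Real.exp_nat_mul]; push_cast; ring_nf
    rw [mul_pow, mul_pow, h4, Real.sq_sqrt hV0nn]
    linarith
  have hcont : ContinuousOn (fun t => ‖x t - xs‖) (Ici 0) := fun t ht =>
    ((hx t ht).continuousWithinAt.sub continuousWithinAt_const).norm
  have hstay : ∀ t, 0 ≤ t → x t ∈ Metric.ball xs r := by
    intro t ht
    by_contra hball
    have hout : r ≤ ‖x t - xs‖ := not_lt.1 fun h => hball (mem_ball_iff_norm.2 h)
    have hcomp : IsCompact (Icc 0 t ∩ {s | r ≤ ‖x s - xs‖}) := by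
      refine isCompact_Icc.of_isClosed_subset ?_ inter_subset_left
      exact (hcont.mono Icc_subset_Ici_self).preimage_isClosed_of_isClosed isClosed_Icc isClosed_Ici
    obtain ⟨T, ⟨⟨hT0, -⟩, hTr⟩, hTmin⟩ := hcomp.exists_isLeast
      ⟨t, right_mem_Icc.2 ht, hout⟩
    have hbefore : ∀ τ ∈ Ico 0 T, x τ ∈ Metric.ball xs r := fun τ hτ => by
      rw [mem_ball_iff_norm]
      by_contra! h
      have hTt : T ≤ t := hTmin ⟨right_mem_Icc.2 ht, hout⟩
      exact absurd (hTmin ⟨⟨hτ.1, hτ.2.le.trans hTt⟩, h⟩) (not_le.2 hτ.2)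
    have hmove := norm_sub_le_of_norm_deriv_le_exp (B := 2 * Real.sqrt (V 0)) hc le_rfl hT0 hx
      fun τ hτ => hspeed τ hτ.1 fun σ hσ => hbefore σ ⟨hσ.1, hσ.2.trans_lt hτ.2⟩
    have hmove' : ‖x T - x 0‖ ≤ 2 * Real.sqrt (V 0) / c := by
      refine hmove.trans (mul_le_of_le_one_right (by positivity) ?_)
      simp [(Real.exp_pos _).le]
    have : ‖x T - xs‖ ≤ ‖x T - x 0‖ + ‖x 0 - xs‖ := norm_sub_le_norm_sub_add_norm_sub _ _ _
    have hTr' : r ≤ ‖x T - xs‖ := hTr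
    linarith
  refine ⟨hstay t ht, hspeed t ht fun τ hτ => hstay τ hτ.1, ?_⟩
  have h1 := henergy t (hstay t ht)
  have h2 := hdecay t ht fun τ hτ => hstay τ hτ.1
  nlinarith [sq_nonneg ‖v t‖]

end

/-- Under the hypotheses of Statement 3, with the optimal damping parameter
`γ = 2√μ`, every Heavy Ball trajectory started in a suitable neighborhood `𝒰` of `(xs, 0)`
converges to some `x' ∈ 𝒮` with the optimal exponential rate:
`‖x(t) − x'‖ ≤ C_ε (‖x(0) − x'‖ + ‖ẋ(0)‖) e^{−(√μ − ε)t}` for all `t ≥ 0`. -/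
theorem stmt_4 {d : ℕ} (f : EuclideanSpace ℝ (Fin d) → ℝ) (hf : ContDiff ℝ 2 f)
    (hbdd : BddBelow (Set.range f)) (xs : EuclideanSpace ℝ (Fin d)) (hmin : IsLocalMin f xs)
    (hPL : LocalPL f xs) (μ L : ℝ) (hμ : 0 < μ) (hμL : μ ≤ L)
    (hspec : ∃ V : Set (EuclideanSpace ℝ (Fin d)), IsOpen V ∧ xs ∈ V ∧
      ∀ p ∈ V, p ∈ minSet f xs → ∀ c : ℝ, c ≠ 0 →
        (∃ v, v ≠ 0 ∧ fderiv ℝ (gradient f) p v = c • v) → c ∈ Set.Icc μ L) :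
    ∃ ε₀ : ℝ, 0 < ε₀ ∧ ∀ ε : ℝ, 0 < ε → ε < ε₀ →
      ∃ 𝒰 : Set (EuclideanSpace ℝ (Fin d) × EuclideanSpace ℝ (Fin d)),
        IsOpen 𝒰 ∧ (xs, (0 : EuclideanSpace ℝ (Fin d))) ∈ 𝒰 ∧
        ∃ C : ℝ, 0 < C ∧
          ∀ x v : ℝ → EuclideanSpace ℝ (Fin d),
            IsHeavyBall f (2 * Real.sqrt μ) x v → (x 0, v 0) ∈ 𝒰 →
            ∃ x' ∈ minSet f xs,
              Filter.Tendsto x Filter.atTop (nhds x') ∧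
              ∀ t : ℝ, 0 ≤ t →
                ‖x t - x'‖ ≤ C * (‖x 0 - x'‖ + ‖v 0‖) *
                  Real.exp (-(Real.sqrt μ - ε) * t) := by
  have hm : 0 < Real.sqrt μ := Real.sqrt_pos.2 hμ
  set m := Real.sqrt μ with hm_def
  have hmμ : m ^ 2 = μ := Real.sq_sqrt hμ.le
  have hdf : Differentiable ℝ f := hf.differentiable (by norm_num)
  have hg1 : ContDiff ℝ 1 (gradient f) := contDiff_gradient hf
  have hdg : Differentiable ℝ (gradient f) := hg1.differentiable (by norm_num)
  have hcG : Continuous (fderiv ℝ (gradient f)) := hg1.continuous_fderiv (by norm_num)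
  have hcrit : ∀ p, IsLocalMin f p → gradient f p = 0 := fun p hp => by
    simp [gradient, hp.fderiv_eq_zero]
  obtain ⟨U, hUo, hxU, ν, hν, hUPL⟩ := hPL
  obtain ⟨V, hVo, hxV, hspecV⟩ := hspec
  set M := ‖fderiv ℝ (gradient f) xs‖ + 1 with hM_def
  have hM : 0 < M := by positivity
  obtain ⟨R, hR, hball⟩ := Metric.eventually_nhds_iff_ball.1 <|
    hmin.and <| (hcG.norm.continuousAt.eventually_le_const
      (show ‖fderiv ℝ (gradient f) xs‖ < M by simp [hM_def])).and <|
      (hUo.eventually_mem hxU).and (hVo.eventually_mem hxV)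
  obtain ⟨a, ha, haM, ha2, haγ⟩ : ∃ a : ℝ, 0 < a ∧ 4 * M * a ≤ 1 ∧ a ≤ 1 / 2 ∧
      a * (2 * M + (2 * m) ^ 2) ≤ 2 * m := by
    refine ⟨min (1 / (4 * M)) (min (1 / 2) (2 * m / (2 * M + (2 * m) ^ 2))), by positivity, ?_, ?_,
      ?_⟩
    · rw [← le_div_iff₀' (by positivity)]
      exact min_le_left _ _
    · exact (min_le_right _ _).trans (min_le_left _ _)
    · rw [← le_div_iff₀ (by positivity)]
      exact (min_le_right _ _).trans (min_le_right _ _)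
  obtain ⟨c, hc, hcγ, hcν⟩ : ∃ c : ℝ, 0 < c ∧ 3 * c ≤ 2 * m ∧ 3 * c ≤ a * ν := by
    refine ⟨min (2 * m / 3) (a * ν / 3), by positivity, ?_, ?_⟩
    · linarith [min_le_left (2 * m / 3) (a * ν / 3)]
    · linarith [min_le_right (2 * m / 3) (a * ν / 3)]
  refine ⟨m, hm, fun ε hε hεm => ?_⟩
  set K := 1 / (2 * m) + 1 / ε with hK
  have hKpos : 0 < K := by positivity
  obtain ⟨η, hη, hηε, hηc⟩ : ∃ η : ℝ, 0 < η ∧ 12 * η * K ≤ ε / 2 ∧ 6 * η * K < c := by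
    refine ⟨min (ε / 2) c / (12 * K), by positivity, ?_, ?_⟩
    · rw [show 12 * (min (ε / 2) c / (12 * K)) * K = min (ε / 2) c by field_simp]
      exact min_le_left _ _
    · rw [show 6 * (min (ε / 2) c / (12 * K)) * K = min (ε / 2) c / 2 by field_simp; norm_num]
      linarith [min_le_right (ε / 2) c]
  obtain ⟨ρ, hρ, hosc⟩ := Metric.eventually_nhds_iff_ball.1 <|
    (hcG.continuousAt (x := xs)).eventually (Metric.closedBall_mem_nhds _ (half_pos hη))
  set r := min (R / 2) ρ with hr_def
  have hr : 0 < r := by positivity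
  have hrR : r ≤ R / 2 := min_le_left _ _
  have hsub : Metric.ball xs r ⊆ Metric.ball xs R := Metric.ball_subset_ball (by linarith)
  have hsub2 : Metric.ball xs (2 * r) ⊆ Metric.ball xs R := Metric.ball_subset_ball (by linarith)
  have hsubρ : Metric.ball xs r ⊆ Metric.ball xs ρ := Metric.ball_subset_ball (min_le_right _ _)
  have hosc' : ∀ p ∈ Metric.ball xs r, ∀ q ∈ Metric.ball xs r,
      ‖fderiv ℝ (gradient f) p - fderiv ℝ (gradient f) q‖ ≤ η := fun p hp q hq => by
    have h1 := hosc p (hsubρ hp)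
    have h2 := hosc q (hsubρ hq)
    rw [dist_eq_norm] at h1 h2
    rw [← sub_sub_sub_cancel_right _ _ (fderiv ℝ (gradient f) xs)]
    exact (norm_sub_le _ _).trans (by linarith)
  have hgsq : ∀ p ∈ Metric.ball xs r, ‖gradient f p‖ ^ 2 ≤ 4 * M * (f p - f xs) := fun p hp =>
    norm_gradient_sq_le hf hM (hcrit xs hmin) (fun q hq => (hball q (hsub2 hq)).1)
      (fun q hq => (hball q (hsub2 hq)).2.1) hp
  have hVcont : Continuous fun w : EuclideanSpace ℝ (Fin d) × EuclideanSpace ℝ (Fin d) =>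
      crossEnergy f xs a w.1 w.2 :=
    (((hdf.continuous.comp continuous_fst).sub continuous_const).add
      ((continuous_snd.norm.pow 2).const_mul _)).add
      (((hg1.continuous.comp continuous_fst).inner continuous_snd).const_mul a)
  have hopen : IsOpen {w : EuclideanSpace ℝ (Fin d) × EuclideanSpace ℝ (Fin d) |
      ‖w.1 - xs‖ < r / 2 ∧ 2 * Real.sqrt (crossEnergy f xs a w.1 w.2) / c < r / 2} := by
    rw [ofPred_and]
    exact (isOpen_lt (continuous_fst.sub continuous_const).norm continuous_const).inter
      (isOpen_lt ((continuous_const.mul hVcont.sqrt).div_const c) continuous_const)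
  refine ⟨{w | ‖w.1 - xs‖ < r / 2 ∧ 2 * Real.sqrt (crossEnergy f xs a w.1 w.2) / c < r / 2},
    hopen,
    by simp [crossEnergy, hr], 2 * K * ((1 + m) + M + ε + 1), by positivity, ?_⟩
  rintro x v ⟨hx, hv⟩ ⟨hx0, hV0⟩
  have hstay := heavyBall_mem_ball_and_decay hf ha.le haM ha2 haγ hc hcγ hcν
    (fun p hp => (hball p (hsub hp)).1) hgsq (fun p hp => hUPL p (hball p (hsub hp)).2.2.1)
    (fun p hp => (hball p (hsub hp)).2.1) hx hv hx0 hV0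
  set B := 2 * Real.sqrt (crossEnergy f xs a (x 0) (v 0)) with hB
  obtain ⟨x', hx'⟩ := exists_limit_of_norm_deriv_le_exp hc hx fun t ht => (hstay t ht).2.1
  have hexp : ∀ b : ℝ, 0 < b → Tendsto (fun t : ℝ => Real.exp (-b * t)) atTop (𝓝 0) := fun b hb =>
    Real.tendsto_exp_atBot.comp (tendsto_id.const_mul_atTop_of_neg (by linarith))
  have hlim : Tendsto x atTop (𝓝 x') := by
    rw [tendsto_iff_norm_sub_tendsto_zero]
    have h0 := (hexp c hc).const_mul (B / c)
    rw [mul_zero] at h0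
    refine squeeze_zero' (Eventually.of_forall fun _ => norm_nonneg _) ?_ h0
    filter_upwards [eventually_ge_atTop 0] with t ht using hx' t ht
  have hx'ball : x' ∈ Metric.ball xs r := by
    rw [mem_ball_iff_norm]
    have h1 := hx' 0 le_rfl
    rw [mul_zero, Real.exp_zero, mul_one, norm_sub_rev] at h1
    have h2 := norm_sub_le_norm_sub_add_norm_sub x' (x 0) xs
    change ‖x 0 - xs‖ < _ at hx0
    change B / c < _ at hV0
    linarith
  have hfx' : f x' = f xs := by
    have h1 : Tendsto (fun t => f (x t) - f xs) atTop (𝓝 (f x' - f xs)) :=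
      ((hdf.continuous.tendsto x').comp hlim).sub_const _
    have h2 : Tendsto (fun t => f (x t) - f xs) atTop (𝓝 0) := by
      have h0 := ((hexp (2 * c) (by linarith)).const_mul
        (crossEnergy f xs a (x 0) (v 0))).const_mul 2
      rw [mul_zero, mul_zero] at h0
      refine squeeze_zero' ?_ ?_ h0
      · filter_upwards [eventually_ge_atTop 0] with t ht
        exact sub_nonneg.2 (hball _ (hsub (hstay t ht).1)).1
      · filter_upwards [eventually_ge_atTop 0] with t ht using (hstay t ht).2.2
    exact sub_eq_zero.1 (tendsto_nhds_unique h1 h2)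
  have hx'min : IsLocalMin f x' := by
    filter_upwards [Metric.isOpen_ball.mem_nhds hx'ball] with p hp
    rw [hfx']
    exact (hball p (hsub hp)).1
  refine ⟨x', ⟨hx'min, hfx'⟩, hlim, fun t ht => ?_⟩
  have hB0 : 0 ≤ B := by positivity
  refine perturbed_oscillator_decay (H := fderiv ℝ (gradient f) x')
    (y := fun t => x t - x') (v := v)
    (r := fun t => gradient f (x t) - fderiv ℝ (gradient f) x' (x t - x'))
    (c := c) (B := max (B / c) B)
    (isSymmetric_fderiv_gradient hf x') hm hε hεm hη.le (hball x' (hsub hx'ball)).2.1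
    (fun e he hev => ?_) hηε hηc (fun t ht => (hx t ht).sub_const x') (fun t ht => ?_)
    (fun t ht => ?_) (fun t ht => ?_) (fun t ht => ?_) ht
  · rw [hmμ]
    exact (hspecV x' (hball x' (hsub hx'ball)).2.2.2 ⟨hx'min, hfx'⟩ e he hev).1
  · rw [add_sub_cancel]
    exact hv t ht
  · have := (convex_ball xs r).norm_image_sub_le_of_norm_fderiv_le' (𝕜 := ℝ)
      (fun p _ => hdg p) (fun p hp => hosc' p hp x' hx'ball) hx'ball (hstay t ht).1
    rwa [hcrit x' hx'min, sub_zero] at this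
  · exact (hx' t ht).trans (by gcongr; exact le_max_left _ _)
  · exact (hstay t ht).2.1.trans (by gcongr; exact le_max_right _ _)
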